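/- Let G be a finite simple graph that is both vertex-transitive and edge-transitive, has at least one edge, has at least one fractional perfect matching, and is d-regular (every vertex has degree d ≥ 1). Then the constant function γ₀ assigning the value 1/d to every edge of G is a fractional perfect matching of G, and γ₀ attains the maximum fractional forcing number: f_f(G,γ₀) = F_f(G). -/

import Mathlib

open Finset

variable {V : Type} [Fintype V] [DecidableEq V]

/-- The sum of `γ` over the edges of `G` incident with the vertex `v`.
(Functions on `E(G)` are encoded as functions on `Sym2 V` vanishing off the edge set.) -/
def vertexSum (G : SimpleGraph V) [DecidableRel G.Adj] (γ : Sym2 V → ℝ) (v : V) : ℝ :=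
  ∑ e ∈ G.edgeFinset, if v ∈ e then γ e else 0

/-- `γ` is a fractional perfect matching of `G`. -/
def IsFPM (G : SimpleGraph V) [DecidableRel G.Adj] (γ : Sym2 V → ℝ) : Prop :=
  (∀ e, 0 ≤ γ e) ∧ (∀ e ∉ G.edgeSet, γ e = 0) ∧ ∀ v, vertexSum G γ v = 1

/-- `α ↑ γ` : `α` is a (nonnegative) forcing function for the fractional perfect matching
`γ`, i.e. `α ⪯ γ` and `γ` is the unique fractional perfect matching `γ'` with `α ⪯ γ'`. -/
def IsForcing (G : SimpleGraph V) [DecidableRel G.Adj] (α γ : Sym2 V → ℝ) : Prop :=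
  (∀ e, 0 ≤ α e) ∧ (∀ e ∉ G.edgeSet, α e = 0) ∧ α ≤ γ ∧
    ∀ γ', IsFPM G γ' → α ≤ γ' → γ' = γ

/-- `|α|`, the sum of the values of `α` over all edges of `G`. -/
def eSum (G : SimpleGraph V) [DecidableRel G.Adj] (α : Sym2 V → ℝ) : ℝ :=
  ∑ e ∈ G.edgeFinset, α e

/-- The fractional forcing number `f_f(G,γ) = min {|α| : α ↑ γ}`. -/
noncomputable def ffN (G : SimpleGraph V) [DecidableRel G.Adj] (γ : Sym2 V → ℝ) : ℝ :=
  sInf {x : ℝ | ∃ α, IsForcing G α γ ∧ x = eSum G α}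

/-- `f_f(G)`, the minimum of `f_f(G,γ)` over all fractional perfect matchings `γ`. -/
noncomputable def ffMin (G : SimpleGraph V) [DecidableRel G.Adj] : ℝ :=
  sInf {x : ℝ | ∃ γ, IsFPM G γ ∧ ffN G γ = x}

/-- `F_f(G)`, the maximum of `f_f(G,γ)` over all fractional perfect matchings `γ`. -/
noncomputable def ffMax (G : SimpleGraph V) [DecidableRel G.Adj] : ℝ :=
  sSup {x : ℝ | ∃ γ, IsFPM G γ ∧ ffN G γ = x}

section Forcing

lemma map_mem_edgeSet_iff {V : Type*} {G : SimpleGraph V} (σ : G ≃g G) (e : Sym2 V) :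
    Sym2.map σ e ∈ G.edgeSet ↔ e ∈ G.edgeSet := by
  induction e with
  | h x y => simp [σ.map_adj_iff]

lemma map_symm_map {V : Type*} {G : SimpleGraph V} (σ : G ≃g G) (e : Sym2 V) :
    Sym2.map σ (Sym2.map σ.symm e) = e := by
  induction e with
  | h x y => simp

lemma sum_edgeFinset_map {V : Type*} {G : SimpleGraph V} [Fintype G.edgeSet] (σ : G ≃g G)
    (f : Sym2 V → ℝ) :
    ∑ e ∈ G.edgeFinset, f (Sym2.map σ e) = ∑ e ∈ G.edgeFinset, f e := by
  refine Finset.sum_bij (fun e _ => Sym2.map σ e) (fun e he => ?_)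
    (fun a _ b _ h => Sym2.map.injective σ.injective h) (fun e he => ?_) fun _ _ => rfl
  · rw [SimpleGraph.mem_edgeFinset] at he ⊢
    exact (map_mem_edgeSet_iff σ e).2 he
  · rw [SimpleGraph.mem_edgeFinset] at he
    exact ⟨Sym2.map σ.symm e, by simpa [map_mem_edgeSet_iff] using he, map_symm_map σ e⟩

variable {G : SimpleGraph V} [DecidableRel G.Adj]

lemma vertexSum_add_mul (γ δ : Sym2 V → ℝ) (t : ℝ) (v : V) :
    vertexSum G (fun e => γ e + t * δ e) v = vertexSum G γ v + t * vertexSum G δ v := by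
  simp only [vertexSum, Finset.mul_sum, ← Finset.sum_add_distrib]
  refine Finset.sum_congr rfl fun e _ => ?_
  split_ifs <;> simp

lemma vertexSum_map (σ : G ≃g G) (γ : Sym2 V → ℝ) (v : V) :
    vertexSum G (fun e => γ (Sym2.map σ e)) v = vertexSum G γ (σ v) := by
  refine Eq.trans (Finset.sum_congr rfl fun e _ => ?_)
    (sum_edgeFinset_map σ fun e => if σ v ∈ e then γ e else 0)
  have : σ v ∈ Sym2.map σ e ↔ v ∈ e := by
    simp [Sym2.mem_map]
  simp only [this]

lemma sum_vertexSum (γ : Sym2 V → ℝ) : ∑ v, vertexSum G γ v = 2 * eSum G γ := by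
  simp only [vertexSum, eSum, Finset.mul_sum]
  rw [Finset.sum_comm]
  refine Finset.sum_congr rfl fun e he => ?_
  rw [SimpleGraph.mem_edgeFinset] at he
  have h := Sym2.card_toFinset_of_not_isDiag e (G.not_isDiag_of_mem_edgeSet he)
  rw [← Finset.sum_filter, Finset.sum_const, nsmul_eq_mul]
  have : (Finset.univ.filter fun v => v ∈ e) = e.toFinset := by ext; simp
  rw [this, h, Nat.cast_ofNat]

lemma IsFPM.two_mul_eSum {γ : Sym2 V → ℝ} (h : IsFPM G γ) :
    2 * eSum G γ = Fintype.card V := by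
  rw [← sum_vertexSum]
  simp [h.2.2]

lemma IsFPM.isForcing_self {γ : Sym2 V → ℝ} (h : IsFPM G γ) : IsForcing G γ γ := by
  refine ⟨h.1, h.2.1, le_rfl, fun γ' h' hle => ?_⟩
  have hs : ∑ e ∈ G.edgeFinset, γ e = ∑ e ∈ G.edgeFinset, γ' e := by
    have h₁ := h.two_mul_eSum
    have h₂ := h'.two_mul_eSum
    simp only [eSum] at h₁ h₂
    linarith
  have hE := (Finset.sum_eq_sum_iff_of_le fun e _ => hle e).1 hs
  ext e
  by_cases he : e ∈ G.edgeSet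
  · exact (hE e (SimpleGraph.mem_edgeFinset.2 he)).symm
  · rw [h.2.1 e he, h'.2.1 e he]

/-- A forcing function excludes every feasible direction that is nonnegative on the edges where
the forcing function is tight. -/
lemma IsForcing.eq_zero_of_nonneg_on_tight {α γ δ : Sym2 V → ℝ} (hα : IsForcing G α γ)
    (hγ : IsFPM G γ) (hδ : ∀ e ∉ G.edgeSet, δ e = 0) (hsum : ∀ v, vertexSum G δ v = 0)
    (hnn : ∀ e ∈ G.edgeSet, α e = γ e → 0 ≤ δ e) : δ = 0 := by
  obtain ⟨hα0, -, hle, huniq⟩ := hα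
  have hev : ∀ e, ∀ᶠ t : ℝ in nhdsWithin 0 (Set.Ioi 0), α e ≤ γ e + t * δ e := by
    intro e
    by_cases he : e ∈ G.edgeSet
    · rcases (hle e).eq_or_lt with h | h
      · filter_upwards [self_mem_nhdsWithin] with t ht
        have := mul_nonneg (le_of_lt ht) (hnn e he h)
        linarith
      · refine Filter.Eventually.filter_mono nhdsWithin_le_nhds ?_
        have hc : ContinuousAt (fun t : ℝ => γ e + t * δ e) 0 := by fun_prop
        have := hc.eventually (lt_mem_nhds (show α e < γ e + 0 * δ e by simpa using h))
        exact this.mono fun t ht => le_of_lt ht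
    · exact Filter.Eventually.of_forall fun t => by simpa [hδ e he] using hle e
  obtain ⟨t, ht, ht0⟩ :=
    ((Filter.eventually_all.2 hev).and (self_mem_nhdsWithin (s := Set.Ioi (0 : ℝ)))).exists
  have key := huniq (fun e => γ e + t * δ e)
    ⟨fun e => (hα0 e).trans (ht e), fun e he => by simp [hδ e he, hγ.2.1 e he],
      fun v => by rw [vertexSum_add_mul, hsum, hγ.2.2]; ring⟩ ht
  ext e
  have := congrFun key e
  have ht0 : t ≠ 0 := ne_of_gt ht0
  simpa [ht0] using this

/-- Automorphic images of the tight set of a forcing function force every fractional perfect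
matching. -/
lemma IsForcing.isForcing_image {α γ₀ γ : Sym2 V → ℝ} (hα : IsForcing G α γ₀)
    (hγ₀ : IsFPM G γ₀) (hγ : IsFPM G γ) (σ : G ≃g G) :
    IsForcing G (fun e => if e ∈ (G.edgeFinset.filter fun e => α e = γ₀ e).image (Sym2.map σ)
      then γ e else 0) γ := by
  refine ⟨fun e => ?_, fun e he => ?_, fun e => ?_, fun γ' hγ' hle => ?_⟩
  · dsimp only
    split_ifs
    exacts [hγ.1 e, le_rfl]
  · simp [hγ.2.1 e he]
  · dsimp only
    split_ifs
    exacts [le_rfl, hγ.1 e]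
  · have h0 := hα.eq_zero_of_nonneg_on_tight (δ := fun e =>
      γ' (Sym2.map σ e) + -1 * γ (Sym2.map σ e)) hγ₀
      (fun e he => by
        have he' := (map_mem_edgeSet_iff σ e).not.2 he
        simp [hγ.2.1 _ he', hγ'.2.1 _ he'])
      (fun v => by
        rw [vertexSum_add_mul (fun e => γ' (Sym2.map σ e)) (fun e => γ (Sym2.map σ e)),
          vertexSum_map, vertexSum_map, hγ.2.2, hγ'.2.2]
        ring)
      (fun e he h => by
        have hmem : Sym2.map σ e ∈ (G.edgeFinset.filter fun e => α e = γ₀ e).image (Sym2.map σ) :=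
          Finset.mem_image_of_mem _ (by simp [he, h])
        have := hle (Sym2.map σ e)
        simp only [hmem, if_true] at this
        linarith)
    ext e
    have := congrFun h0 (Sym2.map σ.symm e)
    simp only [map_symm_map, Pi.zero_apply] at this
    linarith

lemma ffN_le_eSum {α γ : Sym2 V → ℝ} (h : IsForcing G α γ) : ffN G γ ≤ eSum G α :=
  csInf_le ⟨0, by
    rintro x ⟨β, hβ, rfl⟩
    exact Finset.sum_nonneg fun e _ => hβ.1 e⟩ ⟨α, h, rfl⟩

lemma sum_automorphisms_mul_card [Fintype (G ≃g G)]
    (het : ∀ e₁ ∈ G.edgeSet, ∀ e₂ ∈ G.edgeSet, ∃ σ : G ≃g G, Sym2.map σ e₁ = e₂)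
    (γ : Sym2 V → ℝ) {e : Sym2 V} (he : e ∈ G.edgeSet) :
    (∑ σ : G ≃g G, γ (Sym2.map σ e)) * G.edgeFinset.card =
      Fintype.card (G ≃g G) * eSum G γ := by
  have hconst : ∀ e' ∈ G.edgeFinset,
      ∑ σ : G ≃g G, γ (Sym2.map σ e') = ∑ σ : G ≃g G, γ (Sym2.map σ e) := by
    intro e' he'
    obtain ⟨τ, rfl⟩ := het e he e' (SimpleGraph.mem_edgeFinset.1 he')
    refine Fintype.sum_equiv (Equiv.mulRight τ) _ _ fun σ => ?_
    rw [Sym2.map_map]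
    rfl
  calc _ = ∑ e' ∈ G.edgeFinset, ∑ σ : G ≃g G, γ (Sym2.map σ e') := by
        rw [Finset.sum_congr rfl hconst, Finset.sum_const, nsmul_eq_mul, mul_comm]
    _ = _ := by
        rw [Finset.sum_comm]
        simp only [sum_edgeFinset_map, eSum, Finset.sum_const, nsmul_eq_mul, Finset.card_univ]

lemma isFPM_const {d : ℕ} (hd : 1 ≤ d) (hreg : G.IsRegularOfDegree d) :
    IsFPM G (fun e => if e ∈ G.edgeFinset then (1 : ℝ) / d else 0) := by
  refine ⟨fun e => by dsimp only; split_ifs <;> positivity, fun e he => by simp [he], fun v => ?_⟩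
  rw [vertexSum, ← Finset.sum_filter, ← G.incidenceFinset_eq_filter]
  rw [Finset.sum_congr rfl fun e he => if_pos (G.incidenceFinset_subset v he), Finset.sum_const,
    G.card_incidenceFinset_eq_degree, hreg v, nsmul_eq_mul]
  have : (d : ℝ) ≠ 0 := by positivity
  field_simp

lemma ffN_le_ffN_const
    (het : ∀ e₁ ∈ G.edgeSet, ∀ e₂ ∈ G.edgeSet, ∃ σ : G ≃g G, Sym2.map σ e₁ = e₂)
    {d : ℕ} (hd : 1 ≤ d) (hreg : G.IsRegularOfDegree d) {γ : Sym2 V → ℝ} (hγ : IsFPM G γ) :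
    ffN G γ ≤ ffN G (fun e => if e ∈ G.edgeFinset then (1 : ℝ) / d else 0) := by
  classical
  have : Finite (G ≃g G) := DFunLike.finite _
  have := Fintype.ofFinite (G ≃g G)
  set γ₀ : Sym2 V → ℝ := fun e => if e ∈ G.edgeFinset then (1 : ℝ) / d else 0 with hγ₀def
  have hγ₀ : IsFPM G γ₀ := isFPM_const hd hreg
  refine le_csInf ⟨_, γ₀, hγ₀.isForcing_self, rfl⟩ ?_
  rintro _ ⟨α, hα, rfl⟩
  set T := G.edgeFinset.filter fun e => α e = γ₀ e with hT
  have hTα : (T.card : ℝ) * (1 / d) ≤ eSum G α := by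
    rw [eSum, ← nsmul_eq_mul, ← Finset.sum_const]
    refine (Finset.sum_le_sum fun e he => ?_).trans
      (Finset.sum_le_sum_of_subset_of_nonneg (Finset.filter_subset _ _) fun e _ _ => hα.1 e)
    obtain ⟨he, h⟩ := Finset.mem_filter.1 he
    rw [h]
    simp only [hγ₀def, he, if_true, le_refl]
  have hσ (σ : G ≃g G) : ffN G γ ≤ ∑ e ∈ T, γ (Sym2.map σ e) := by
    refine (ffN_le_eSum (hα.isForcing_image hγ₀ hγ σ)).trans_eq ?_
    rw [eSum, Finset.sum_ite_mem, Finset.inter_eq_right.2,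
      Finset.sum_image (Sym2.map.injective σ.injective).injOn]
    intro e he
    obtain ⟨e', he', rfl⟩ := Finset.mem_image.1 he
    rw [SimpleGraph.mem_edgeFinset, map_mem_edgeSet_iff, ← SimpleGraph.mem_edgeFinset]
    exact (Finset.mem_filter.1 he').1
  have horbit : ∀ e ∈ T,
      ∑ σ : G ≃g G, γ (Sym2.map σ e) = Fintype.card (G ≃g G) * (1 / d) := by
    intro e he
    have he := (Finset.mem_filter.1 he).1
    have hcard : (0 : ℝ) < G.edgeFinset.card := by exact_mod_cast Finset.card_pos.2 ⟨e, he⟩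
    have h₀ : eSum G γ₀ = G.edgeFinset.card * (1 / d) := by
      rw [eSum, Finset.sum_congr rfl fun e he => if_pos he, Finset.sum_const, nsmul_eq_mul]
    have hγs : eSum G γ = eSum G γ₀ := by linarith [hγ.two_mul_eSum, hγ₀.two_mul_eSum]
    have := sum_automorphisms_mul_card het γ (SimpleGraph.mem_edgeFinset.1 he)
    rw [hγs, h₀] at this
    refine mul_right_cancel₀ hcard.ne' ?_
    rw [this]
    ring
  have hsum := Finset.sum_le_sum fun (σ : G ≃g G) (_ : σ ∈ Finset.univ) => hσ σ
  rw [Finset.sum_comm, Finset.sum_congr rfl horbit, Finset.sum_const, Finset.sum_const,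
    nsmul_eq_mul, nsmul_eq_mul, Finset.card_univ] at hsum
  have hpos : (0 : ℝ) < Fintype.card (G ≃g G) := by
    exact_mod_cast Fintype.card_pos_iff.2 ⟨SimpleGraph.Iso.refl⟩
  refine le_trans (le_of_mul_le_mul_left ?_ hpos) hTα
  linarith

end Forcing

/-- In a vertex- and edge-transitive `d`-regular graph (with an edge and a fractional
perfect matching), the constant function `1/d` on the edges is a fractional perfect
matching attaining the maximum fractional forcing number. -/
theorem constant_attains_ffMax (G : SimpleGraph V) [DecidableRel G.Adj]
    (hvt : ∀ u v : V, ∃ σ : G ≃g G, σ u = v)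
    (het : ∀ e₁ ∈ G.edgeSet, ∀ e₂ ∈ G.edgeSet, ∃ σ : G ≃g G, Sym2.map σ e₁ = e₂)
    (hedge : G.edgeSet.Nonempty) (hfpm : ∃ γ, IsFPM G γ)
    (d : ℕ) (hd : 1 ≤ d) (hreg : G.IsRegularOfDegree d) :
    IsFPM G (fun e => if e ∈ G.edgeFinset then (1 : ℝ) / d else 0) ∧
      ffN G (fun e => if e ∈ G.edgeFinset then (1 : ℝ) / d else 0) = ffMax G := by
  exact ⟨isFPM_const hd hreg, Eq.symm <| IsGreatest.csSup_eq
    ⟨⟨_, isFPM_const hd hreg, rfl⟩, by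
      rintro x ⟨γ, hγ, rfl⟩
      exact ffN_le_ffN_const het hd hreg hγ⟩⟩
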